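/- arXiv:2312.09486 — 2 statements merged into one kernel-verified Lean document; each statement's English description precedes it below -/
import Mathlib

section
/- For natural numbers N ≥ 1, K ≥ 1 and k with 1 ≤ k, the number of multisets of cardinality N over a K-element type (equivalently, elements of Sym (Fin K) N) whose support has exactly k distinct elements equals C(K,k)·C(N−1,k−1). -/
open Finset

/-- The multisets of cardinality `N` with support exactly `S` correspond to the multisets over `S`
of cardinality `N - #S`, by removing one copy of every element of `S`. -/
theorem card_sym_filter_toFinset_eq {α : Type*} [Fintype α] [DecidableEq α] {N : ℕ} (hN : 1 ≤ N)
    (S : Finset α) (hS : 1 ≤ #S) :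
    #{s : Sym α N | (s : Multiset α).toFinset = S} = (N - 1).choose (#S - 1) := by
  rcases lt_or_ge N #S with hlt | hle
  · rw [Nat.choose_eq_zero_of_lt (by omega), card_eq_zero, filter_eq_empty_iff]
    rintro s - rfl
    have := Multiset.toFinset_card_le (s : Multiset α)
    rw [Sym.card_coe] at this
    omega
  · have hcard : Fintype.card (Sym S (N - #S)) = (N - 1).choose (#S - 1) := by
      rw [Sym.card_sym_eq_choose, Fintype.card_coe,
        show #S + (N - #S) - 1 = N - 1 by omega]
      exact Nat.choose_symm_of_eq_add (by omega)
    rw [← hcard, ← card_univ]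
    symm
    refine card_bij (fun m _ => Sym.mk (S.val + (m : Multiset S).map Subtype.val) ?_) ?_ ?_ ?_
    · rw [Multiset.card_add, Multiset.card_map, Sym.card_coe, card_val]
      omega
    · intro m _
      rw [mem_filter_univ]
      ext a
      simp only [Sym.coe_mk, Multiset.mem_toFinset, Multiset.mem_add, mem_val, Multiset.mem_map]
      constructor
      · rintro (h | ⟨b, -, rfl⟩)
        exacts [h, b.2]
      · exact Or.inl
    · intro m _ m' _ h
      exact Sym.coe_injective
        (Multiset.map_injective Subtype.val_injective (add_left_cancel (Subtype.ext_iff.1 h)))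
    · intro t ht
      rw [mem_filter_univ] at ht
      have hle : S.val ≤ (t : Multiset α) := by
        rw [← ht, Multiset.toFinset_val]
        exact Multiset.dedup_le _
      obtain ⟨m, hm⟩ : ∃ m : Multiset S, m.map Subtype.val = (t : Multiset α) - S.val := by
        refine CanLift.prf ((t : Multiset α) - S.val) fun a ha => ?_
        rw [← ht, Multiset.mem_toFinset]
        exact Multiset.mem_of_le (Multiset.sub_le_self _ _) ha
      refine ⟨Sym.mk m ?_, mem_univ _, Sym.coe_injective ?_⟩
      · rw [← Multiset.card_map Subtype.val, hm, Multiset.card_sub hle, Sym.card_coe, card_val]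
      · simp only [Sym.coe_mk, hm]
        exact add_tsub_cancel_of_le hle

/-- For `N ≥ 1`, `K ≥ 1` and `k ≥ 1`, the number of multisets of cardinality `N` over a
`K`-element type (elements of `Sym (Fin K) N`) whose support has exactly `k` distinct
elements equals `C(K,k) · C(N−1,k−1)`. -/
theorem multiset_count_support_card (N K k : ℕ) (hN : 1 ≤ N) (hK : 1 ≤ K) (hk : 1 ≤ k) :
    (Finset.univ.filter
        (fun s : Sym (Fin K) N => (s : Multiset (Fin K)).toFinset.card = k)).card
      = K.choose k * (N - 1).choose (k - 1) := by
  rw [card_eq_sum_card_fiberwise (f := fun s : Sym (Fin K) N => (s : Multiset (Fin K)).toFinset)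
      (t := powersetCard k univ) fun s hs => by simpa using hs,
    sum_const_nat (m := (N - 1).choose (k - 1)), card_powersetCard, card_univ, Fintype.card_fin]
  intro S hS
  obtain rfl := (mem_powersetCard.1 hS).2
  rw [filter_filter, ← card_sym_filter_toFinset_eq hN S hk]
  congr 1
  refine filter_congr fun s _ => and_iff_right_of_imp ?_
  rintro rfl
  rfl
end

section
/- (Proposition 1, counting form.) For natural numbers N ≥ 1 and K ≥ 1, the sum over all multisets s of cardinality N over Fin K of the cardinality of the support of s equals Σ_{k=1}^{K} k·C(K,k)·C(N−1,k−1). -/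
open Finset

/-- Multisets of size `n + 1` containing a fixed element correspond to multisets of size `n`. -/
lemma Sym.card_filter_mem {α : Type*} [Fintype α] [DecidableEq α] (a : α) (n : ℕ) :
    #{s : Sym α (n + 1) | a ∈ s} = Fintype.card (Sym α n) := by
  have h : ({s : Sym α (n + 1) | a ∈ s} : Finset _) = univ.image (Sym.cons a) := by
    ext s
    simp only [mem_filter, mem_univ, true_and, mem_image]
    constructor
    · exact fun hs => ⟨s.erase a hs, Sym.cons_erase hs⟩
    · rintro ⟨t, rfl⟩
      exact Sym.mem_cons_self a t
  rw [h, card_image_of_injective _ fun s t => (Sym.cons_inj_right a s t).1, card_univ]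

/-- Double counting the pairs `(s, a)` with `a ∈ s`. -/
lemma Sym.sum_card_toFinset {α : Type*} [Fintype α] [DecidableEq α] (n : ℕ) :
    ∑ s : Sym α (n + 1), (s : Multiset α).toFinset.card
      = Fintype.card α * Fintype.card (Sym α n) := by
  have h (s : Sym α (n + 1)) :
      (s : Multiset α).toFinset.card = ∑ a : α, if a ∈ s then 1 else 0 := by
    rw [← card_filter]
    congr 1
    ext a
    simp
  rw [sum_congr rfl fun s _ => h s, sum_comm]
  simp only [← card_filter, Sym.card_filter_mem, sum_const, card_univ, smul_eq_mul]

lemma Nat.sum_range_choose_mul_choose (m n : ℕ) :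
    ∑ j ∈ range (m + 1), m.choose j * n.choose j = (m + n).choose n := by
  rw [← Nat.choose_symm_add, Nat.add_choose_eq, ← Nat.sum_antidiagonal_swap,
    Nat.sum_antidiagonal_eq_sum_range_succ_mk]
  refine sum_congr rfl fun j hj => ?_
  simp only [Prod.swap, Nat.choose_symm (mem_range_succ_iff.1 hj)]

/-- (Proposition 1, counting form.) For `N ≥ 1` and `K ≥ 1`, the sum over all multisets
`s` of cardinality `N` over `Fin K` of the cardinality of the support of `s` equals
`Σ_{k=1}^{K} k·C(K,k)·C(N−1,k−1)`. -/
theorem sum_support_card_eq (N K : ℕ) (hN : 1 ≤ N) (hK : 1 ≤ K) :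
    ∑ s : Sym (Fin K) N, (s : Multiset (Fin K)).toFinset.card
      = ∑ k ∈ Finset.Icc 1 K, k * (K.choose k * (N - 1).choose (k - 1)) := by
  obtain ⟨n, rfl⟩ := Nat.exists_eq_add_of_le' hN
  obtain ⟨m, rfl⟩ := Nat.exists_eq_add_of_le' hK
  rw [Sym.sum_card_toFinset, Sym.card_sym_eq_choose, Fintype.card_fin,
    ← Ico_add_one_right_eq_Icc, sum_Ico_eq_sum_range]
  simp only [Nat.add_sub_cancel, Nat.add_sub_cancel_left,
    Nat.add_right_comm m 1 n]
  rw [← Nat.sum_range_choose_mul_choose, mul_sum]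
  refine sum_congr rfl fun j _ => ?_
  rw [← mul_assoc, ← mul_assoc, Nat.add_one_mul_choose_eq, add_comm 1 j,
    mul_comm ((m + 1).choose (j + 1))]
end
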